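/- Let 1 ≤ k ≤ n. For every λ ∈ Γ_k and every index i ∈ {1,…,n}, the partial derivative ∂σ_k/∂λ_i (λ), which equals σ_{k-1;i}(λ), is strictly positive. -/

import Mathlib

/-- The `m`-th elementary symmetric polynomial of `λ ∈ ℝⁿ`. -/
noncomputable def esymm (n m : ℕ) (lam : Fin n → ℝ) : ℝ :=
  ∑ s ∈ Finset.powersetCard m (Finset.univ : Finset (Fin n)), ∏ i ∈ s, lam i

/-- The Gårding cone `Γ_k`. -/
def GardingCone (n k : ℕ) : Set (Fin n → ℝ) :=
  {lam | ∀ j, 1 ≤ j → j ≤ k → 0 < esymm n j lam}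

/-- `σ_{m;i}(λ)`: the `m`-th elementary symmetric polynomial of `λ` with the entry
`λ_i` replaced by `0`. -/
noncomputable def esymmDel (n m : ℕ) (i : Fin n) (lam : Fin n → ℝ) : ℝ :=
  esymm n m (Function.update lam i 0)

open Polynomial in
/-- The generating polynomial `∏ i, (1 + λ_i X)` of the elementary symmetric polynomials. -/
noncomputable def esymmPoly {n : ℕ} (lam : Fin n → ℝ) : ℝ[X] :=
  ∏ i, (1 + C (lam i) * X)

open Polynomial in
theorem coeff_esymmPoly {n : ℕ} (lam : Fin n → ℝ) (m : ℕ) :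
    (esymmPoly lam).coeff m = esymm n m lam := by
  have h : ∀ s : Finset (Fin n),
      (∏ i ∈ s, (C (lam i) * X : ℝ[X])).coeff m = if s.card = m then ∏ i ∈ s, lam i else 0 := by
    intro s
    rw [Finset.prod_mul_distrib, Finset.prod_const, ← map_prod, coeff_C_mul_X_pow]
    simp only [eq_comm]
  rw [esymmPoly, Finset.prod_one_add, finsetSum_coeff, esymm, Finset.powersetCard_eq_filter,
    Finset.sum_filter]
  exact Finset.sum_congr rfl fun s _ => h s

open Polynomial in
theorem splits_esymmPoly {n : ℕ} (lam : Fin n → ℝ) : (esymmPoly lam).Splits := by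
  refine Splits.prod fun i _ => Splits.of_natDegree_le_one ?_
  compute_degree

open Polynomial in
theorem esymmPoly_update {n : ℕ} (lam : Fin n → ℝ) (i : Fin n) (t : ℝ) :
    esymmPoly (Function.update lam i t) =
      (1 + C t * X) * esymmPoly (Function.update lam i 0) := by
  unfold esymmPoly
  rw [← Finset.mul_prod_erase _ _ (Finset.mem_univ i),
    ← Finset.mul_prod_erase _ (fun j => 1 + C (Function.update lam i 0 j) * X)
      (Finset.mem_univ i)]
  simp only [Function.update_self, map_zero, zero_mul, add_zero, one_mul]
  congr 1
  refine Finset.prod_congr rfl fun j hj => ?_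
  simp [Function.update_of_ne (Finset.ne_of_mem_erase hj)]

open Polynomial in
theorem esymm_succ_update (n m : ℕ) (lam : Fin n → ℝ) (i : Fin n) (t : ℝ) :
    esymm n (m + 1) (Function.update lam i t) =
      esymmDel n (m + 1) i lam + t * esymmDel n m i lam := by
  simp only [esymmDel, ← coeff_esymmPoly]
  rw [esymmPoly_update, add_mul, one_mul, coeff_add, mul_assoc, coeff_C_mul, coeff_X_mul]

open Polynomial in
/-- The derivative of a real-rooted polynomial is real-rooted. -/
theorem Polynomial.Splits.derivative_real {p : ℝ[X]} (hp : p.Splits) :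
    (derivative p).Splits := by
  rw [splits_iff_card_roots] at hp ⊢
  have h₁ := card_roots_le_derivative p
  have h₂ := natDegree_derivative_le p
  have h₃ := card_roots' (derivative p)
  omega

open Polynomial in
/-- The Laguerre inequality for real-rooted polynomials. -/
theorem Polynomial.Splits.eval_mul_eval_derivative_le {p : ℝ[X]} (hp : p.Splits) (x : ℝ) :
    p.eval x * (derivative (derivative p)).eval x ≤ (derivative p).eval x ^ 2 := by
  have key : ∀ s : Multiset ℝ, ∀ q : ℝ[X], q = (s.map fun a => X - C a).prod →
      q.eval x * (derivative (derivative q)).eval x ≤ (derivative q).eval x ^ 2 := by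
    intro s
    induction s using Multiset.induction_on with
    | empty => rintro _ rfl; simp
    | cons a s ih =>
      rintro _ rfl
      have h := ih _ rfl
      rw [Multiset.map_cons, Multiset.prod_cons]
      generalize (s.map fun a => X - C a).prod = q at h ⊢
      simp only [derivative_mul, derivative_add, derivative_sub, derivative_X, derivative_C,
        eval_add, eval_mul, eval_sub, eval_X, eval_C, sub_zero, one_mul]
      nlinarith [sq_nonneg (q.eval x), mul_le_mul_of_nonneg_left h (sq_nonneg (x - a))]
  have h := key p.roots _ rfl
  rw [hp.eq_prod_roots]
  generalize (p.roots.map fun a => X - C a).prod = q at h ⊢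
  simp only [derivative_C_mul, eval_mul, eval_C]
  nlinarith [mul_le_mul_of_nonneg_left h (sq_nonneg p.leadingCoeff)]

open Polynomial in
/-- A form of Newton's inequality for the coefficients of a real-rooted polynomial. -/
theorem Polynomial.Splits.newton_coeff {p : ℝ[X]} (hp : p.Splits) (m : ℕ) :
    (m + 2) * (p.coeff m * p.coeff (m + 2)) ≤ (m + 1) * p.coeff (m + 1) ^ 2 := by
  have hs : (derivative^[m] p).Splits := by
    induction m with
    | zero => exact hp
    | succ m ih => rw [Function.iterate_succ_apply']; exact ih.derivative_real
  have h := hs.eval_mul_eval_derivative_le 0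
  simp only [← Function.iterate_succ_apply' (⇑derivative), ← coeff_zero_eq_eval_zero,
    coeff_iterate_derivative, zero_add, Nat.descFactorial_self, nsmul_eq_mul, Nat.succ_eq_add_one,
    Nat.factorial_succ, add_assoc, Nat.reduceAdd] at h
  push_cast at h
  have hf : (0 : ℝ) < (m.factorial : ℝ) ^ 2 * (m + 1) := by positivity
  refine le_of_mul_le_mul_left ?_ hf
  linarith

theorem esymm_mul_esymm_le_sq (n m : ℕ) (lam : Fin n → ℝ) :
    esymm n m lam * esymm n (m + 2) lam ≤ esymm n (m + 1) lam ^ 2 := by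
  have h := (splits_esymmPoly lam).newton_coeff m
  simp only [coeff_esymmPoly] at h
  have hm : (0 : ℝ) < m + 2 := by positivity
  refine le_of_mul_le_mul_left ?_ hm
  nlinarith [sq_nonneg (esymm n (m + 1) lam)]

theorem esymmDel_pos_of_mem_gardingCone {n m : ℕ} {lam : Fin n → ℝ}
    (hlam : lam ∈ GardingCone n (m + 1)) (i : Fin n) : 0 < esymmDel n m i lam := by
  induction m with
  | zero => simp [esymmDel, esymm]
  | succ m ih =>
    have h₀ := ih fun j h₁ h₂ => hlam j h₁ (by omega)
    have h₁ := hlam (m + 1) (by omega) (by omega)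
    have h₂ := hlam (m + 2) (by omega) (by omega)
    rw [← Function.update_eq_self i lam, esymm_succ_update] at h₁ h₂
    have hN : esymmDel n m i lam * esymmDel n (m + 2) i lam ≤ esymmDel n (m + 1) i lam ^ 2 :=
      esymm_mul_esymm_le_sq n m _
    by_contra! hneg
    have h₃ := mul_pos h₀ h₂
    have h₄ := mul_nonneg (neg_nonneg.2 hneg) h₁.le
    nlinarith

/-- for `1 ≤ k ≤ n`, `λ ∈ Γ_k` and each index `i`, the partial
derivative `∂σ_k/∂λ_i (λ)` equals `σ_{k-1;i}(λ)` and is strictly positive. -/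
theorem stmt15 (n k : ℕ) (hk : 1 ≤ k) (hkn : k ≤ n)
    (lam : Fin n → ℝ) (hlam : lam ∈ GardingCone n k) (i : Fin n) :
    HasDerivAt (fun t : ℝ => esymm n k (Function.update lam i t))
      (esymmDel n (k - 1) i lam) (lam i) ∧
    0 < esymmDel n (k - 1) i lam := by
  obtain ⟨m, rfl⟩ : ∃ m, k = m + 1 := ⟨k - 1, by omega⟩
  rw [Nat.add_sub_cancel]
  refine ⟨?_, esymmDel_pos_of_mem_gardingCone hlam i⟩
  simp only [esymm_succ_update]
  simpa using ((hasDerivAt_id (lam i)).mul_const (esymmDel n m i lam)).const_add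
    (esymmDel n (m + 1) i lam)
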